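/- arXiv:2412.08401 — 4 statements merged into one kernel-verified Lean document; each statement's English description precedes it below -/
import Mathlib

section
/- The Frobenius algebra structure on A is compatible with the Shumakovitch–Wang differential: letting Δ : A → A ⊗_k A be the k-linear map determined by Δ(x^j) = Σ_{i=0}^{p-1} x^{i+j} ⊗ x^{p-1-i} (the comultiplication of the Frobenius structure, characterized as the A-bimodule map with Δ(1) = Σ_{i=0}^{p-1} x^i ⊗ x^{p-1-i}), and ε : A → k the k-linear map with ε(x^i) = 1 if i = p-1 and ε(x^i) = 0 otherwise, one has Δ ∘ D = (D ⊗ id + id ⊗ D) ∘ Δ and ε ∘ D = 0. -/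
open Polynomial TensorProduct

noncomputable section

/-- The truncated polynomial algebra `A = k[X]/(X^p)`. -/
abbrev TruncPoly (k : Type*) [Field k] (p : ℕ) : Type _ :=
  Polynomial k ⧸ Ideal.span {(Polynomial.X : Polynomial k) ^ p}

/-- The image `x` of the variable `X` in `A = k[X]/(X^p)`. -/
def truncX (k : Type*) [Field k] (p : ℕ) : TruncPoly k p :=
  Ideal.Quotient.mk _ Polynomial.X

theorem truncX_pow_eq_zero (k : Type*) [Field k] {p i : ℕ} (h : p ≤ i) :
    truncX k p ^ i = 0 := by
  rw [truncX, ← map_pow, Ideal.Quotient.eq_zero_iff_mem, Ideal.mem_span_singleton]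
  exact pow_dvd_pow _ h

/-- Linear maps out of `k[X]/(X^p)` are determined by their values on `x^i` for `i < p`. -/
theorem truncPoly_linearMap_ext {k : Type*} [Field k] {p : ℕ} {M : Type*} [AddCommMonoid M]
    [Module k M] {f g : TruncPoly k p →ₗ[k] M}
    (h : ∀ i < p, f (truncX k p ^ i) = g (truncX k p ^ i)) : f = g := by
  refine LinearMap.ext fun a => ?_
  obtain ⟨q, rfl⟩ := Ideal.Quotient.mk_surjective a
  induction q using Polynomial.induction_on' with
  | add q r hq hr => simp only [map_add, hq, hr]
  | monomial n c =>
    have hx : Ideal.Quotient.mk (Ideal.span {(X : k[X]) ^ p}) (monomial n c) =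
        c • truncX k p ^ n := by
      rw [← C_mul_X_pow_eq_monomial, ← smul_eq_C_mul, truncX, ← map_pow]
      rfl
    rw [hx, map_smul, map_smul]
    rcases lt_or_ge n p with hn | hn
    · rw [h n hn]
    · rw [truncX_pow_eq_zero k hn, map_zero, map_zero]

/-- In characteristic `p`, the formula for the differential on `x^i` holds for all `i`. -/
theorem differential_truncX_pow {k : Type*} [Field k] {p : ℕ} [CharP k p]
    {D : TruncPoly k p →ₗ[k] TruncPoly k p}
    (hD : ∀ i : ℕ, i < p → D (truncX k p ^ i) = -((i : k) • truncX k p ^ (i - 1))) (i : ℕ) :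
    D (truncX k p ^ i) = -((i : k) • truncX k p ^ (i - 1)) := by
  rcases lt_trichotomy i p with hi | rfl | hi
  · exact hD i hi
  · rw [truncX_pow_eq_zero k le_rfl, CharP.cast_eq_zero, zero_smul, map_zero, neg_zero]
  · rw [truncX_pow_eq_zero k hi.le, truncX_pow_eq_zero k (Nat.le_sub_one_of_lt hi), smul_zero,
      map_zero, neg_zero]

/-- The Frobenius algebra structure on `A = k[X]/(X^p)` is compatible with the
Shumakovitch–Wang differential `D = -d/dx`:
`Δ ∘ D = (D ⊗ id + id ⊗ D) ∘ Δ` and `ε ∘ D = 0`. -/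
theorem frobenius_compatible_with_SW_differential
    (k : Type*) [Field k] (p : ℕ) [Fact p.Prime] [CharP k p]
    (D : TruncPoly k p →ₗ[k] TruncPoly k p)
    (hD : ∀ i : ℕ, i < p → D (truncX k p ^ i) = -((i : k) • truncX k p ^ (i - 1)))
    (Δ : TruncPoly k p →ₗ[k] TensorProduct k (TruncPoly k p) (TruncPoly k p))
    (hΔ : ∀ j : ℕ, j < p → Δ (truncX k p ^ j) =
      ∑ i ∈ Finset.range p, (truncX k p ^ (i + j)) ⊗ₜ[k] (truncX k p ^ (p - 1 - i)))
    (ε : TruncPoly k p →ₗ[k] k)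
    (hε : ∀ i : ℕ, i < p → ε (truncX k p ^ i) = if i = p - 1 then 1 else 0) :
    Δ ∘ₗ D =
      (TensorProduct.map D LinearMap.id + TensorProduct.map LinearMap.id D) ∘ₗ Δ ∧
    ε ∘ₗ D = 0 := by
  have hD' := differential_truncX_pow hD
  refine ⟨truncPoly_linearMap_ext fun j hj => ?_, truncPoly_linearMap_ext fun j hj => ?_⟩
  · let F : ℕ → TruncPoly k p ⊗[k] TruncPoly k p := fun i =>
      (i : k) • ((truncX k p ^ (i + j - 1)) ⊗ₜ[k] (truncX k p ^ (p - 1 - i)))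
    have hF : ∑ i ∈ Finset.range p, (F (i + 1) - F i) = 0 := by
      rw [Finset.sum_range_sub]
      simp [F]
    have hterm : ∀ i ∈ Finset.range p,
        D (truncX k p ^ (i + j)) ⊗ₜ[k] (truncX k p ^ (p - 1 - i)) +
          (truncX k p ^ (i + j)) ⊗ₜ[k] D (truncX k p ^ (p - 1 - i)) =
        -((j : k) • ((truncX k p ^ (i + (j - 1))) ⊗ₜ[k] (truncX k p ^ (p - 1 - i)))) +
          (F (i + 1) - F i) := by
      intro i hi
      have hc : ((p - 1 - i : ℕ) : k) = -((i : k) + 1) := by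
        have h : (p - 1 - i) + (i + 1) = p := by
          have := Finset.mem_range.mp hi
          omega
        have h' := congrArg (Nat.cast (R := k)) h
        push_cast at h'
        rw [CharP.cast_eq_zero k p] at h'
        exact eq_neg_of_add_eq_zero_left h'
      have hj' : (j : k) • ((truncX k p ^ (i + (j - 1))) ⊗ₜ[k] (truncX k p ^ (p - 1 - i))) =
          (j : k) • ((truncX k p ^ (i + j - 1)) ⊗ₜ[k] (truncX k p ^ (p - 1 - i))) := by
        rcases j with _ | j
        · simp
        · rfl
      have hs : F (i + 1) = ((i : k) + 1) •
          ((truncX k p ^ (i + j)) ⊗ₜ[k] (truncX k p ^ (p - 1 - i - 1))) := by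
        simp only [F, Nat.cast_add, Nat.cast_one]
        rw [show i + 1 + j - 1 = i + j by omega, Nat.sub_sub (p - 1) i 1]
      rw [hj', hs, hD', hD', hc, TensorProduct.neg_tmul, TensorProduct.tmul_neg,
        TensorProduct.tmul_smul, ← TensorProduct.smul_tmul']
      simp only [F]
      module
    have hL : Δ (D (truncX k p ^ j)) = ∑ i ∈ Finset.range p,
        -((j : k) • ((truncX k p ^ (i + (j - 1))) ⊗ₜ[k] (truncX k p ^ (p - 1 - i)))) := by
      rw [hD', map_neg, map_smul, hΔ (j - 1) (by omega), Finset.smul_sum,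
        Finset.sum_neg_distrib]
    simp only [LinearMap.comp_apply, LinearMap.add_apply]
    rw [hL, hΔ j hj, map_sum, map_sum, ← Finset.sum_add_distrib]
    simp only [TensorProduct.map_tmul, LinearMap.id_apply]
    rw [Finset.sum_congr rfl hterm, Finset.sum_add_distrib, hF, add_zero]
  · rw [LinearMap.comp_apply, hD', map_neg, map_smul, hε (j - 1) (by omega),
      LinearMap.zero_apply]
    rcases j with _ | j
    · simp
    · rw [if_neg (by omega), smul_zero, neg_zero]
end
end

section
/- Let n ≥ 1, let R = k[X₁, ..., X_n]/(X₁^p, ..., X_n^p) with x_i the image of X_i, and let ∂ : R → R be the k-derivation with ∂(x_i) = -1 for all i (that is, ∂ = -(∂/∂x₁ + ... + ∂/∂x_n)). Then the k-algebra homomorphism φ : k[Y₂, ..., Y_n, Z]/(Y₂^p, ..., Y_n^p, Z^p) → R determined by φ(y_i) = x₁ - x_i for 2 ≤ i ≤ n and φ(z) = x₁ is an isomorphism of k-algebras, and it intertwines the k-derivation D_Z of the source determined by D_Z(y_i) = 0 for all i and D_Z(z) = -1 with ∂, i.e. φ ∘ D_Z = ∂ ∘ φ. -/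
set_option synthInstance.maxHeartbeats 1000000
set_option maxHeartbeats 1000000

noncomputable section

/-- The truncated polynomial algebra in `n` variables `k[X₁,…,X_n]/(X₁^p,…,X_n^p)`. -/
abbrev TruncMv (k : Type*) [Field k] (p n : ℕ) : Type _ :=
  MvPolynomial (Fin n) k ⧸
    Ideal.span (Set.range fun i : Fin n => (MvPolynomial.X i : MvPolynomial (Fin n) k) ^ p)

/-- The image of the variable `Xᵢ` in `k[X₁,…,X_n]/(X₁^p,…,X_n^p)`. -/
def truncMvX (k : Type*) [Field k] (p n : ℕ) (i : Fin n) : TruncMv k p n :=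
  Ideal.Quotient.mk _ (MvPolynomial.X i)

theorem truncMvX_pow (k : Type*) [Field k] (p n : ℕ) (i : Fin n) :
    truncMvX k p n i ^ p = 0 := by
  rw [truncMvX, ← map_pow]
  exact Ideal.Quotient.eq_zero_iff_mem.2 (Ideal.subset_span ⟨i, rfl⟩)

theorem truncMvX_sub_pow (k : Type*) [Field k] (p : ℕ) [Fact p.Prime] [CharP k p]
    (n : ℕ) (i j : Fin n) : (truncMvX k p n i - truncMvX k p n j) ^ p = 0 := by
  have h : (truncMvX k p n i - truncMvX k p n j) ^ p =
      truncMvX k p n i ^ p - truncMvX k p n j ^ p := by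
    simp only [truncMvX, ← map_sub, ← map_pow, sub_pow_char]
  rw [h, truncMvX_pow, truncMvX_pow, sub_zero]

/-- The algebra map out of the truncated polynomial algebra sending the `i`-th variable
to `v i`. -/
def truncMvLift {k : Type*} [Field k] {p n : ℕ} {A : Type*} [CommRing A] [Algebra k A]
    (v : Fin n → A) (hv : ∀ i, v i ^ p = 0) : TruncMv k p n →ₐ[k] A :=
  Ideal.Quotient.liftₐ _ (MvPolynomial.aeval v) (by
    intro a ha
    rw [← RingHom.mem_ker]
    refine (Ideal.span_le.2 ?_ : _ ≤ RingHom.ker (MvPolynomial.aeval v)) ha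
    rintro _ ⟨i, rfl⟩
    simp [RingHom.mem_ker, hv])

theorem truncMvLift_X {k : Type*} [Field k] {p n : ℕ} {A : Type*} [CommRing A] [Algebra k A]
    (v : Fin n → A) (hv : ∀ i, v i ^ p = 0) (i : Fin n) :
    truncMvLift v hv (truncMvX k p n i) = v i :=
  MvPolynomial.aeval_X v i

theorem truncMv_induction {k : Type*} [Field k] {p n : ℕ} {P : TruncMv k p n → Prop}
    (algebraMap : ∀ c : k, P (algebraMap k _ c)) (add : ∀ a b, P a → P b → P (a + b))
    (mul_X : ∀ a i, P a → P (a * truncMvX k p n i)) (s : TruncMv k p n) : P s := by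
  obtain ⟨f, rfl⟩ := Ideal.Quotient.mk_surjective s
  induction f using MvPolynomial.induction_on with
  | C c => exact algebraMap c
  | add f g hf hg => rw [map_add]; exact add _ _ hf hg
  | mul_X f i hf => rw [map_mul]; exact mul_X _ i hf

theorem truncMv_algHom_ext {k : Type*} [Field k] {p n : ℕ} {A : Type*} [CommRing A]
    [Algebra k A] {f g : TruncMv k p n →ₐ[k] A}
    (h : ∀ i, f (truncMvX k p n i) = g (truncMvX k p n i)) : f = g :=
  Ideal.Quotient.algHom_ext _ (MvPolynomial.algHom_ext h)

/-- An algebra map intertwines two derivations as soon as it does so on the variables. -/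
theorem truncMv_map_derivation {k : Type*} [Field k] {p n : ℕ} {A : Type*} [CommRing A]
    [Algebra k A] (f : TruncMv k p n →ₐ[k] A)
    (D : Derivation k (TruncMv k p n) (TruncMv k p n)) (E : Derivation k A A)
    (h : ∀ i, f (D (truncMvX k p n i)) = E (f (truncMvX k p n i))) (s : TruncMv k p n) :
    f (D s) = E (f s) := by
  induction s using truncMv_induction with
  | algebraMap c => rw [D.map_algebraMap, f.commutes, E.map_algebraMap, map_zero]
  | add a b ha hb => rw [map_add, map_add, map_add, map_add, ha, hb]
  | mul_X a i ha =>
    rw [D.leibniz, map_mul, E.leibniz, map_add]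
    simp only [smul_eq_mul, map_mul, ha, h]

/-- Let `n ≥ 1`, `R = k[X₁,…,X_n]/(X₁^p,…,X_n^p)` and `∂` the derivation with
`∂xᵢ = -1` for all `i`.  The algebra map `φ` from
`k[Y₂,…,Y_n,Z]/(Y₂^p,…,Y_n^p,Z^p)` (here the variable indexed `0` is `Z` and the
variable indexed `i ≠ 0` is `Y_{i+1}`) to `R` determined by `φ(yᵢ) = x₁ - xᵢ`
and `φ(z) = x₁` is an isomorphism of `k`-algebras intertwining the derivation
`D_Z` (with `D_Z(yᵢ) = 0`, `D_Z(z) = -1`) with `∂`. -/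
theorem change_of_variables_n_vars
    (k : Type*) [Field k] (p : ℕ) [Fact p.Prime] [CharP k p]
    (n : ℕ) (hn : 1 ≤ n)
    (del : Derivation k (TruncMv k p n) (TruncMv k p n))
    (hdel : ∀ i : Fin n, del (truncMvX k p n i) = -1)
    (DZ : Derivation k (TruncMv k p n) (TruncMv k p n))
    (hz : DZ (truncMvX k p n ⟨0, hn⟩) = -1)
    (hy : ∀ i : Fin n, i ≠ ⟨0, hn⟩ → DZ (truncMvX k p n i) = 0) :
    ∃ φ : TruncMv k p n ≃ₐ[k] TruncMv k p n,
      φ (truncMvX k p n ⟨0, hn⟩) = truncMvX k p n ⟨0, hn⟩ ∧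
      (∀ i : Fin n, i ≠ ⟨0, hn⟩ →
        φ (truncMvX k p n i) = truncMvX k p n ⟨0, hn⟩ - truncMvX k p n i) ∧
      ∀ s : TruncMv k p n, φ (DZ s) = del (φ s) := by
  classical
  set o : Fin n := ⟨0, hn⟩
  let v : Fin n → TruncMv k p n := fun i =>
    if i = o then truncMvX k p n o else truncMvX k p n o - truncMvX k p n i
  have hv : ∀ i, v i ^ p = 0 := fun i => by
    by_cases hi : i = o
    · simp only [v, if_pos hi, truncMvX_pow]
    · simp only [v, if_neg hi, truncMvX_sub_pow]
  let f : TruncMv k p n →ₐ[k] TruncMv k p n := truncMvLift v hv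
  have hfo : f (truncMvX k p n o) = truncMvX k p n o :=
    (truncMvLift_X v hv o).trans (if_pos rfl)
  have hfi : ∀ i, i ≠ o → f (truncMvX k p n i) = truncMvX k p n o - truncMvX k p n i :=
    fun i hi => (truncMvLift_X v hv i).trans (if_neg hi)
  have hff : f.comp f = AlgHom.id k _ := truncMv_algHom_ext fun i => by
    rw [AlgHom.comp_apply, AlgHom.id_apply]
    by_cases hi : i = o
    · rw [hi, hfo, hfo]
    · rw [hfi i hi, map_sub, hfo, hfi i hi, sub_sub_cancel]
  refine ⟨AlgEquiv.ofAlgHom f f hff hff, hfo, hfi, truncMv_map_derivation f DZ del fun i => ?_⟩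
  by_cases hi : i = o
  · rw [hi, hz, hfo, hdel, map_neg, map_one]
  · rw [hy i hi, hfi i hi, map_sub, hdel, hdel, sub_self, map_zero]
end
end

section
/- For every integer λ, the dual of the baby Verma module Δ(λ) is isomorphic to Δ(2p-2-λ): there exists a k-linear isomorphism T from the dual space of Δ(λ) to Δ(2p-2-λ) such that T ∘ (-∂₊(λ)ᵀ) = ∂₊(2p-2-λ) ∘ T, T ∘ (-∂₋(λ)ᵀ) = ∂₋(2p-2-λ) ∘ T, and T ∘ (-∂₀(λ)ᵀ) = ∂₀(2p-2-λ) ∘ T, where ∂•(μ) denote the operators of Δ(μ) and ᵀ denotes the transpose (dual) linear map. -/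
noncomputable section

/-- The defining property of the operators `∂₊, ∂₋, ∂₀` of the baby Verma module
`Δ(λ)` on the `k`-vector space with basis `u_0, …, u_{p-1}`:
`∂₊(uᵢ) = (i+1)u_{i+1}`, `∂₋(uᵢ) = (λ-i+1)u_{i-1}`, `∂₀(uᵢ) = (λ-2i)uᵢ`
(with `u_{-1} = u_p = 0`). -/
def IsBabyVermaOps (k : Type*) [Field k] (p : ℕ) (lam : ℤ)
    (Pp Pm P0 : Module.End k (Fin p → k)) : Prop :=
  (∀ i : Fin p, Pp (Pi.single i 1) =
    if h : (i : ℕ) + 1 < p then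
      (((i : ℕ) + 1 : ℕ) : k) • (Pi.single (⟨(i : ℕ) + 1, h⟩ : Fin p) 1 : Fin p → k)
    else 0) ∧
  (∀ i : Fin p, Pm (Pi.single i 1) =
    if (i : ℕ) = 0 then 0 else
      ((lam - (i : ℕ) + 1 : ℤ) : k) •
        (Pi.single (⟨(i : ℕ) - 1, lt_of_le_of_lt (Nat.sub_le _ _) i.isLt⟩ : Fin p) 1 :
          Fin p → k)) ∧
  (∀ i : Fin p, P0 (Pi.single i 1) =
    ((lam - 2 * (i : ℕ) : ℤ) : k) • (Pi.single i 1 : Fin p → k))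

/-- The linear isomorphism from the dual of `kⁿ` to `kⁿ` sending the `j`-th dual basis vector to
the `(n - 1 - j)`-th standard basis vector. -/
def dualRevEquiv (k : Type*) [Field k] (n : ℕ) : Module.Dual k (Fin n → k) ≃ₗ[k] (Fin n → k) :=
  (Pi.basisFun k (Fin n)).dualBasis.equiv (Pi.basisFun k (Fin n)) Fin.revPerm

theorem dualRevEquiv_coord (k : Type*) [Field k] (n : ℕ) (j : Fin n) :
    dualRevEquiv k n ((Pi.basisFun k (Fin n)).coord j) = Pi.single j.rev 1 := by
  rw [← Module.Basis.coe_dualBasis, dualRevEquiv, Module.Basis.equiv_apply, Pi.basisFun_apply,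
    Fin.revPerm_apply]

theorem dualRevEquiv_apply (k : Type*) [Field k] (n : ℕ) (φ : Module.Dual k (Fin n → k))
    (m : Fin n) : dualRevEquiv k n φ m = φ (Pi.single m.rev 1) := by
  have h : LinearMap.proj m ∘ₗ (dualRevEquiv k n).toLinearMap =
      Module.Dual.eval k (Fin n → k) (Pi.single m.rev 1) := by
    refine (Pi.basisFun k (Fin n)).dualBasis.ext fun j => ?_
    have hjm : j = m.rev ↔ m = j.rev := by rw [← Fin.rev_eq_iff, eq_comm]
    simp [dualRevEquiv_coord, Pi.single_apply, hjm]
  exact LinearMap.congr_fun h φ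

/-- `dualRevEquiv` intertwines `-Pᵀ` with `Q` as soon as the matrix of `Q` is the negative of the
anti-transpose of the matrix of `P`. -/
theorem dualRevEquiv_intertwines {k : Type*} [Field k] {n : ℕ} {P Q : Module.End k (Fin n → k)}
    (h : ∀ j m : Fin n, -(P (Pi.single m.rev 1) j) = Q (Pi.single j.rev 1) m) :
    (dualRevEquiv k n).toLinearMap ∘ₗ (-(P.dualMap)) = Q ∘ₗ (dualRevEquiv k n).toLinearMap := by
  refine (Pi.basisFun k (Fin n)).dualBasis.ext fun j => ?_
  ext m
  simp [dualRevEquiv_coord, dualRevEquiv_apply, ← h]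

/-- For every integer `λ`, the dual of the baby Verma module `Δ(λ)` is
isomorphic to `Δ(2p-2-λ)`: there is a linear isomorphism `T` from the dual
space of `Δ(λ)` to `Δ(2p-2-λ)` intertwining the dual operators `-∂•(λ)ᵀ` with
the operators `∂•(2p-2-λ)`. -/
theorem babyVerma_dual_iso
    (k : Type*) [Field k] (p : ℕ) [Fact p.Prime] [CharP k p] (hp2 : 2 < p)
    (lam : ℤ)
    (Pp Pm P0 : Module.End k (Fin p → k))
    (hP : IsBabyVermaOps k p lam Pp Pm P0)
    (Qp Qm Q0 : Module.End k (Fin p → k))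
    (hQ : IsBabyVermaOps k p (2 * (p : ℤ) - 2 - lam) Qp Qm Q0) :
    ∃ T : Module.Dual k (Fin p → k) ≃ₗ[k] (Fin p → k),
      T.toLinearMap ∘ₗ (-(Pp.dualMap)) = Qp ∘ₗ T.toLinearMap ∧
      T.toLinearMap ∘ₗ (-(Pm.dualMap)) = Qm ∘ₗ T.toLinearMap ∧
      T.toLinearMap ∘ₗ (-(P0.dualMap)) = Q0 ∘ₗ T.toLinearMap := by
  have hp : (p : k) = 0 := CharP.cast_eq_zero k p
  obtain ⟨hPp, hPm, hP0⟩ := hP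
  obtain ⟨hQp, hQm, hQ0⟩ := hQ
  refine ⟨dualRevEquiv k p, dualRevEquiv_intertwines fun j m => ?_,
    dualRevEquiv_intertwines fun j m => ?_, dualRevEquiv_intertwines fun j m => ?_⟩
  · rw [hPp, hQp]
    by_cases hjm : (j : ℕ) + m = p
    · have hk : (j : k) + m = 0 := by
        exact_mod_cast (congrArg (Nat.cast : ℕ → k) hjm).trans hp
      have h1 : (m.rev : ℕ) + 1 = j := by rw [Fin.val_rev]; omega
      have h2 : (j.rev : ℕ) + 1 = m := by rw [Fin.val_rev]; omega
      simp only [h1, h2, Fin.is_lt, dite_true, Fin.eta, Pi.smul_apply, Pi.single_eq_same,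
        smul_eq_mul, mul_one]
      linear_combination -hk
    · have h1 : (j : ℕ) ≠ m.rev + 1 := by rw [Fin.val_rev]; omega
      have h2 : (m : ℕ) ≠ j.rev + 1 := by rw [Fin.val_rev]; omega
      split_ifs <;> simp [Fin.ext_iff, h1, h2, -Fin.val_rev]
  · rw [hPm, hQm]
    by_cases hjm : (j : ℕ) + m + 2 = p
    · have hk : (j : k) + m + 2 = 0 := by
        exact_mod_cast (congrArg (Nat.cast : ℕ → k) hjm).trans hp
      have h1 : (m.rev : ℕ) = j + 1 := by rw [Fin.val_rev]; omega
      have h2 : (j.rev : ℕ) = m + 1 := by rw [Fin.val_rev]; omega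
      simp only [h1, h2, Nat.succ_ne_zero, if_false, Nat.add_sub_cancel, Fin.eta, Pi.smul_apply,
        Pi.single_eq_same, smul_eq_mul, mul_one]
      push_cast
      linear_combination hk - 2 * hp
    · have hr1 := Fin.val_rev m
      have hr2 := Fin.val_rev j
      have h1 : (m.rev : ℕ) ≠ 0 → (j : ℕ) ≠ m.rev - 1 := by omega
      have h2 : (j.rev : ℕ) ≠ 0 → (m : ℕ) ≠ j.rev - 1 := by omega
      split_ifs with ha hb hb <;>
        simp [Pi.single_apply, Fin.ext_iff, -Fin.val_rev] <;> grind
  · rw [hP0, hQ0]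
    by_cases hjm : (j : ℕ) + m + 1 = p
    · have hk : (j : k) + m + 1 = 0 := by
        exact_mod_cast (congrArg (Nat.cast : ℕ → k) hjm).trans hp
      have h1 : m.rev = j := by ext; rw [Fin.val_rev]; omega
      have h2 : j.rev = m := by ext; rw [Fin.val_rev]; omega
      simp only [h1, h2, Pi.smul_apply, Pi.single_eq_same, smul_eq_mul, mul_one]
      push_cast
      linear_combination 2 * hk - 2 * hp
    · have h1 : j ≠ m.rev := by rw [Ne, Fin.ext_iff, Fin.val_rev]; omega
      have h2 : m ≠ j.rev := by rw [Ne, Fin.ext_iff, Fin.val_rev]; omega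
      simp [h1, h2]
end
end

section
/- For λ = p-1, the baby Verma module and the dual baby Verma module coincide and give the Steinberg module: the operators of Δ(p-1) and of ∇(p-1) on the k-vector space with basis indexed by 0, ..., p-1 are equal (that is, for all i, (p-1)-i+1 = -i and i+1 = i-(p-1) as scalars in k), and this representation is irreducible: every k-subspace invariant under both ∂₊ and ∂₋ is either zero or the whole space. -/
noncomputable section

section IsBabyVermaOps

variable {k : Type*} [Field k] {p : ℕ} {lam : ℤ} {Pp Pm P0 : Module.End k (Fin p → k)}

theorem IsBabyVermaOps.lower_apply (hP : IsBabyVermaOps k p lam Pp Pm P0) (v : Fin p → k)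
    (j : ℕ) (hj : j + 1 < p) :
    Pm v ⟨j, by omega⟩ = v ⟨j + 1, hj⟩ * ((lam - (j + 1 : ℕ) + 1 : ℤ) : k) := by
  conv_lhs => rw [pi_eq_sum_univ' v]
  rw [map_sum, Finset.sum_apply, Finset.sum_eq_single ⟨j + 1, hj⟩]
  · have h := hP.2.1 ⟨j + 1, hj⟩
    simp only [Nat.add_one_ne_zero, if_false, Nat.add_sub_cancel] at h
    simp [h]
  · intro i _ hi
    have h := hP.2.1 i
    rw [map_smul, h]
    split_ifs with h0
    · simp
    · have : (⟨j, by omega⟩ : Fin p) ≠ ⟨(i : ℕ) - 1, by omega⟩ := by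
        intro e
        apply hi
        simp only [Fin.mk.injEq] at e
        ext
        simp only
        omega
      simp [Pi.single_eq_of_ne this]
  · simp

theorem IsBabyVermaOps.lower_apply_last (hP : IsBabyVermaOps k p lam Pp Pm P0) (v : Fin p → k)
    (j : ℕ) (hj : j + 1 = p) : Pm v ⟨j, by omega⟩ = 0 := by
  rw [pi_eq_sum_univ' v, map_sum, Finset.sum_apply]
  refine Finset.sum_eq_zero fun i _ => ?_
  rw [map_smul, hP.2.1 i]
  split_ifs with h0
  · simp
  · have : (⟨j, by omega⟩ : Fin p) ≠ ⟨(i : ℕ) - 1, by omega⟩ := by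
      intro e
      simp only [Fin.mk.injEq] at e
      omega
    simp [Pi.single_eq_of_ne this]

/-- If no lowering coefficient vanishes, then a subspace stable under `∂₋` that contains a vector
with leading index `m` contains `u₀`. -/
theorem IsBabyVermaOps.single_zero_mem (hP : IsBabyVermaOps k p lam Pp Pm P0)
    (hlam : ∀ j : ℕ, j + 1 < p → ((lam - (j + 1 : ℕ) + 1 : ℤ) : k) ≠ 0)
    {N : Submodule k (Fin p → k)} (hN : ∀ v ∈ N, Pm v ∈ N) (m : ℕ) (hm : m < p)
    (v : Fin p → k) (hv : v ∈ N) (hvm : v ⟨m, hm⟩ ≠ 0) (hv0 : ∀ i : Fin p, m < i → v i = 0) :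
    (Pi.single ⟨0, by omega⟩ 1 : Fin p → k) ∈ N := by
  induction m generalizing v with
  | zero =>
    have h : v = v ⟨0, hm⟩ • (Pi.single ⟨0, hm⟩ 1 : Fin p → k) := by
      ext i
      by_cases hi : i = ⟨0, hm⟩
      · subst hi; simp
      · rw [hv0 i (Nat.pos_of_ne_zero fun h => hi (Fin.ext h))]
        simp [Pi.single_eq_of_ne hi]
    rw [h] at hv
    exact (N.smul_mem_iff hvm).1 hv
  | succ m ih =>
    refine ih (by omega) (Pm v) (hN v hv) ?_ ?_
    · rw [hP.lower_apply v m hm]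
      exact mul_ne_zero hvm (hlam m hm)
    · rintro ⟨i, hi⟩ hmi
      simp only at hmi
      by_cases hip : i + 1 < p
      · rw [hP.lower_apply v i hip, hv0 ⟨i + 1, hip⟩ (by simpa using hmi), zero_mul]
      · exact hP.lower_apply_last v i (by omega)

theorem IsBabyVermaOps.single_mem [CharP k p] (hP : IsBabyVermaOps k p lam Pp Pm P0)
    {N : Submodule k (Fin p → k)} (hN : ∀ v ∈ N, Pp v ∈ N) (hp : 0 < p)
    (h0 : (Pi.single ⟨0, hp⟩ 1 : Fin p → k) ∈ N) (j : ℕ) (hj : j < p) :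
    (Pi.single ⟨j, hj⟩ 1 : Fin p → k) ∈ N := by
  induction j with
  | zero => exact h0
  | succ j ih =>
    have h := hN _ (ih (by omega))
    rw [hP.1, dif_pos hj] at h
    refine (N.smul_mem_iff fun e => ?_).1 h
    exact Nat.not_dvd_of_pos_of_lt j.succ_pos hj ((CharP.cast_eq_zero_iff k p _).1 e)

end IsBabyVermaOps

/-- For `λ = p-1`, the baby Verma module and the dual baby Verma module
coincide and give the Steinberg module: the structure constants agree, i.e.
for all `i`, `(p-1)-i+1 = -i` and `i+1 = i-(p-1)` as scalars in `k`, and the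
representation is irreducible: every subspace invariant under both `∂₊` and
`∂₋` is zero or the whole space. -/
theorem steinberg_module
    (k : Type*) [Field k] (p : ℕ) [Fact p.Prime] [CharP k p] (hp2 : 2 < p)
    (Pp Pm P0 : Module.End k (Fin p → k))
    (hP : IsBabyVermaOps k p ((p : ℤ) - 1) Pp Pm P0) :
    (∀ i : Fin p,
      ((((p : ℤ) - 1) - (i : ℕ) + 1 : ℤ) : k) = -((i : ℕ) : k) ∧
      (((i : ℕ) + 1 : ℕ) : k) = ((i : ℕ) : k) - (((p : ℤ) - 1 : ℤ) : k)) ∧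
    ∀ N : Submodule k (Fin p → k),
      (∀ v ∈ N, Pp v ∈ N) → (∀ v ∈ N, Pm v ∈ N) → N = ⊥ ∨ N = ⊤ := by
  refine ⟨fun i => ⟨by simp; ring, by simp⟩, fun N hNp hNm => ?_⟩
  have hlam : ∀ j : ℕ, j + 1 < p → ((((p : ℤ) - 1) - (j + 1 : ℕ) + 1 : ℤ) : k) ≠ 0 := by
    intro j hj e
    have h : ((j + 1 : ℕ) : k) = 0 := by
      rw [← neg_eq_zero, ← e]
      push_cast
      rw [CharP.cast_eq_zero k p]
      ring
    exact Nat.not_dvd_of_pos_of_lt j.succ_pos hj ((CharP.cast_eq_zero_iff k p _).1 h)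
  classical
  refine or_iff_not_imp_left.2 fun hne => ?_
  obtain ⟨v, hv, hv0⟩ := N.exists_mem_ne_zero_of_ne_bot hne
  obtain ⟨i, hi⟩ := Function.ne_iff.1 hv0
  obtain ⟨m, hm, hmax⟩ := (Finset.univ.filter fun i => v i ≠ 0).exists_max_image id
    ⟨i, by simpa using hi⟩
  have h0 := hP.single_zero_mem hlam hNm m m.isLt v hv (by simpa using hm) fun l hl => by
    by_contra hl0
    exact absurd (hmax l (by simpa using hl0)) (not_le.2 hl)
  rw [eq_top_iff]
  intro w _
  rw [pi_eq_sum_univ' w]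
  refine N.sum_mem fun l _ => N.smul_mem _ ?_
  simpa [← Pi.single_apply] using hP.single_mem hNp (by omega) h0 l l.isLt
end
end
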